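/- arXiv:1710.02950 — 6 statements merged into one kernel-verified Lean document; each statement's English description precedes it below -/
import Mathlib

section
/- Let L be a nonempty convex subset of a real Hilbert space H, let ν be a σ-finite measure on a measurable space 𝒳, and let (f_Λ)_{Λ∈L} be a family of strictly positive probability densities with respect to ν. Fix Λ* ∈ L and an observed data point x₀ ∈ 𝒳, and define the Kullback–Leibler loss d(Λ) := ∫ log(f_{Λ*}(y)/f_Λ(y)) f_{Λ*}(y) dν(y) and its empirical version d̂(Λ) := log(f_{Λ*}(x₀)/f_Λ(x₀)), both assumed finite for every Λ ∈ L. Let u be a regularizer with dual ũ, let r > 0 be such that u(Λ*) < ∞ and u(−Λ*) < ∞, and let Λ̂ ∈ L minimize Λ ↦ −log f_Λ(x₀) + r·u(Λ) over L. Suppose G ∈ H is a subgradient of d − d̂ at Λ̂ on L, i.e. d(Λ) − d̂(Λ) ≥ d(Λ̂) − d̂(Λ̂) + ⟨G, Λ − Λ̂⟩ for all Λ ∈ L. Then, whenever r ≥ ũ(G), it holds that d(Λ̂) ≤ r·u(Λ*) + r·u(−Λ*). -/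
open scoped ENNReal RealInnerProductSpace
open MeasureTheory

/-- A regularizer on a real Hilbert space: `u Λ = 0` iff `Λ = 0`, and `u` is
positively homogeneous of degree one. -/
def IsRegularizer {H : Type*} [NormedAddCommGroup H] [InnerProductSpace ℝ H]
    (u : H → ℝ≥0∞) : Prop :=
  (∀ Λ : H, u Λ = 0 ↔ Λ = 0) ∧
    ∀ (Λ : H) (t : ℝ), Λ ≠ 0 → 0 ≤ t → u (t • Λ) = ENNReal.ofReal t * u Λ

/-- The dual of a regularizer: `ũ(Λ) = sup { ⟨Λ, Λ'⟩ : u(Λ') ≤ 1 }`. -/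
noncomputable def dualReg {H : Type*} [NormedAddCommGroup H] [InnerProductSpace ℝ H]
    (u : H → ℝ≥0∞) (Λ : H) : ℝ≥0∞ :=
  ⨆ (Λ' : H) (_ : u Λ' ≤ 1), ENNReal.ofReal ⟪Λ, Λ'⟫

/-- The Hölder-type inequality `⟨G, Λ⟩ ≤ r u(Λ)` for `r ≥ ũ(G)` and `u(Λ)` finite. -/
theorem IsRegularizer.inner_le_mul_toReal
    {H : Type*} [NormedAddCommGroup H] [InnerProductSpace ℝ H]
    {u : H → ℝ≥0∞} (hu : IsRegularizer u) {r : ℝ} (hr : 0 ≤ r) {G Λ : H}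
    (hG : dualReg u G ≤ ENNReal.ofReal r) (hΛ : u Λ ≠ ⊤) :
    ⟪G, Λ⟫ ≤ r * (u Λ).toReal := by
  by_cases h0 : Λ = 0
  · simpa [h0] using mul_nonneg hr ENNReal.toReal_nonneg
  have hpos : 0 < (u Λ).toReal := ENNReal.toReal_pos (fun h => h0 ((hu.1 Λ).1 h)) hΛ
  have hunit : u ((u Λ).toReal⁻¹ • Λ) ≤ 1 := by
    rw [hu.2 Λ _ h0 (inv_nonneg.2 hpos.le)]
    nth_rewrite 2 [← ENNReal.ofReal_toReal hΛ]
    rw [← ENNReal.ofReal_mul (inv_nonneg.2 hpos.le), inv_mul_cancel₀ hpos.ne',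
      ENNReal.ofReal_one]
  have hle : ENNReal.ofReal ⟪G, (u Λ).toReal⁻¹ • Λ⟫ ≤ ENNReal.ofReal r :=
    (le_iSup₂ (f := fun (Λ' : H) (_ : u Λ' ≤ 1) => ENNReal.ofReal ⟪G, Λ'⟫) _ hunit).trans hG
  rw [ENNReal.ofReal_le_ofReal_iff hr, real_inner_smul_right, inv_mul_le_iff₀ hpos] at hle
  linarith

/-- the general oracle inequality for maximum regularized likelihood
estimators, in Kullback-Leibler loss. -/
theorem mrle_oracle_inequality
    {H : Type*} [NormedAddCommGroup H] [InnerProductSpace ℝ H] [CompleteSpace H]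
    {𝒳 : Type*} [MeasurableSpace 𝒳] (ν : Measure 𝒳) [SigmaFinite ν]
    (L : Set H) (hLne : L.Nonempty) (hLconv : Convex ℝ L)
    -- the family of strictly positive probability densities with respect to `ν`
    (f : H → 𝒳 → ℝ)
    (hf_pos : ∀ Λ ∈ L, ∀ y, 0 < f Λ y)
    (hf_meas : ∀ Λ ∈ L, Measurable (f Λ))
    (hf_int : ∀ Λ ∈ L, Integrable (f Λ) ν)
    (hf_prob : ∀ Λ ∈ L, ∫ y, f Λ y ∂ν = 1)
    -- the true parameter and the observed data point
    (Λstar : H) (hΛstar : Λstar ∈ L) (x₀ : 𝒳)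
    -- the Kullback-Leibler loss and its empirical version
    (d dhat : H → ℝ)
    (hd : ∀ Λ, d Λ = ∫ y, Real.log (f Λstar y / f Λ y) * f Λstar y ∂ν)
    (hdhat : ∀ Λ, dhat Λ = Real.log (f Λstar x₀ / f Λ x₀))
    -- finiteness of the Kullback-Leibler loss on `L`
    (hd_fin : ∀ Λ ∈ L,
      Integrable (fun y => Real.log (f Λstar y / f Λ y) * f Λstar y) ν)
    -- the regularizer
    (u : H → ℝ≥0∞) (hu : IsRegularizer u)
    (r : ℝ) (hr : 0 < r) (hufin : u Λstar < ⊤) (hufin' : u (-Λstar) < ⊤)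
    -- the maximum regularized likelihood estimator
    (Λhat : H) (hΛhat : Λhat ∈ L)
    (hmin : ∀ Λ ∈ L,
      ((-Real.log (f Λhat x₀) : ℝ) : EReal) + ((ENNReal.ofReal r * u Λhat : ℝ≥0∞) : EReal)
        ≤ ((-Real.log (f Λ x₀) : ℝ) : EReal) + ((ENNReal.ofReal r * u Λ : ℝ≥0∞) : EReal))
    -- a subgradient of `d - d̂` at `Λ̂` on `L`
    (G : H)
    (hG : ∀ Λ ∈ L, d Λ - dhat Λ ≥ d Λhat - dhat Λhat + ⟪G, Λ - Λhat⟫)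
    -- the regularization parameter dominates the dual of the regularizer at `G`
    (hrG : dualReg u G ≤ ENNReal.ofReal r) :
    d Λhat ≤ r * (u Λstar).toReal + r * (u (-Λstar)).toReal := by
  have hself : ∀ y, Real.log (f Λstar y / f Λstar y) = 0 := fun y => by
    rw [div_self (hf_pos Λstar hΛstar y).ne', Real.log_one]
  have hdstar : d Λstar = 0 := by simp [hd, hself]
  have hdhatstar : dhat Λstar = 0 := by simp [hdhat, hself]
  have hcoe : ∀ Λ, u Λ ≠ ⊤ →
      ((ENNReal.ofReal r * u Λ : ℝ≥0∞) : EReal) = ((r * (u Λ).toReal : ℝ) : EReal) := by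
    intro Λ h
    rw [← EReal.coe_toReal (x := ((ENNReal.ofReal r * u Λ : ℝ≥0∞) : EReal))
      (EReal.coe_ennreal_eq_top_iff.not.2 (ENNReal.mul_ne_top ENNReal.ofReal_ne_top h))
      (EReal.coe_ennreal_ne_bot _),
      EReal.toReal_coe_ennreal, ENNReal.toReal_mul, ENNReal.toReal_ofReal hr.le]
  have hmin_star := hmin Λstar hΛstar
  rw [hcoe Λstar hufin.ne, ← EReal.coe_add] at hmin_star
  have hhat : u Λhat ≠ ⊤ := by
    intro h
    rw [h, ENNReal.mul_top (by simpa using hr), EReal.coe_ennreal_top, EReal.coe_add_top,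
      top_le_iff] at hmin_star
    exact EReal.coe_ne_top _ hmin_star
  rw [hcoe Λhat hhat, ← EReal.coe_add, EReal.coe_le_coe_iff] at hmin_star
  have hsub := hG Λstar hΛstar
  have hinner := hu.inner_le_mul_toReal hr.le hrG hhat
  have hinner_neg := hu.inner_le_mul_toReal hr.le hrG hufin'.ne
  have hlog := hdhat Λhat
  rw [Real.log_div (hf_pos Λstar hΛstar x₀).ne' (hf_pos Λhat hΛhat x₀).ne'] at hlog
  rw [inner_sub_right, hdstar, hdhatstar] at hsub
  rw [inner_neg_right] at hinner_neg
  linarith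
end

section
/- Let L be a nonempty convex subset of a real Hilbert space H, let d, d̂ : L → ℝ, and fix Λ* ∈ L with d(Λ*) = 0. Let u be a regularizer with u(Λ*) < ∞, let r > 0, and let Λ̂ ∈ L minimize Λ ↦ d̂(Λ) + r·u(Λ) over L. Suppose G ∈ H satisfies the subgradient inequality d(Λ) − d̂(Λ) ≥ d(Λ̂) − d̂(Λ̂) + ⟨G, Λ − Λ̂⟩ for all Λ ∈ L. Then u(Λ̂) < ∞ and the enhanced basic inequality d(Λ̂) ≤ r·u(Λ*) − r·u(Λ̂) + ⟨G, Λ̂⟩ + ⟨G, −Λ*⟩ holds. -/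
open scoped ENNReal RealInnerProductSpace

/-- the enhanced basic inequality. -/
theorem enhanced_basic_inequality
    {H : Type*} [NormedAddCommGroup H] [InnerProductSpace ℝ H] [CompleteSpace H]
    (L : Set H) (hLne : L.Nonempty) (hLconv : Convex ℝ L)
    (d dhat : H → ℝ)
    (Λstar : H) (hΛstar : Λstar ∈ L) (hdstar : d Λstar = 0)
    (u : H → ℝ≥0∞) (hu : IsRegularizer u) (hufin : u Λstar < ⊤)
    (r : ℝ) (hr : 0 < r)
    (Λhat : H) (hΛhat : Λhat ∈ L)
    (hmin : ∀ Λ ∈ L,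
      ((dhat Λhat : ℝ) : EReal) + ((ENNReal.ofReal r * u Λhat : ℝ≥0∞) : EReal)
        ≤ ((dhat Λ : ℝ) : EReal) + ((ENNReal.ofReal r * u Λ : ℝ≥0∞) : EReal))
    (G : H)
    (hG : ∀ Λ ∈ L, d Λ - dhat Λ ≥ d Λhat - dhat Λhat + ⟪G, Λ - Λhat⟫) :
    u Λhat < ⊤ ∧
      d Λhat ≤ r * (u Λstar).toReal - r * (u Λhat).toReal
        + ⟪G, Λhat⟫ + ⟪G, -Λstar⟫ := by
  have hstar := hmin Λstar hΛstar
  have hstar_ne : ENNReal.ofReal r * u Λstar ≠ ⊤ :=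
    ENNReal.mul_ne_top ENNReal.ofReal_ne_top hufin.ne
  have hhat : u Λhat < ⊤ := by
    rw [lt_top_iff_ne_top]
    intro htop
    rw [htop, ENNReal.mul_top (ENNReal.ofReal_pos.2 hr).ne', EReal.coe_ennreal_top,
      EReal.coe_add_top, top_le_iff, ← EReal.coe_ennreal_toReal hstar_ne, ← EReal.coe_add] at hstar
    exact EReal.coe_ne_top _ hstar
  refine ⟨hhat, ?_⟩
  have hhat_ne : ENNReal.ofReal r * u Λhat ≠ ⊤ :=
    ENNReal.mul_ne_top ENNReal.ofReal_ne_top hhat.ne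
  rw [← EReal.coe_ennreal_toReal hhat_ne, ← EReal.coe_ennreal_toReal hstar_ne,
    ← EReal.coe_add, ← EReal.coe_add, EReal.coe_le_coe_iff, ENNReal.toReal_mul,
    ENNReal.toReal_mul, ENNReal.toReal_ofReal hr.le] at hstar
  have hsub := hG Λstar hΛstar
  rw [inner_sub_right, hdstar] at hsub
  rw [inner_neg_right]
  linarith
end

section
/- Let Λ* ∈ ℝ^{b₁}, let z¹,…,zⁿ ∈ ℝ^{b₁} and y¹,…,yⁿ ∈ ℝ. Define pⁱ := e^{⟨Λ*,zⁱ⟩}/(1 + e^{⟨Λ*,zⁱ⟩}) and the logistic Kullback–Leibler loss d(Λ) := Σ_{i=1}^n ( pⁱ·⟨Λ* − Λ, zⁱ⟩ − log(1 + e^{⟨Λ*,zⁱ⟩}) + log(1 + e^{⟨Λ,zⁱ⟩}) ). Let u be a regularizer on ℝ^{b₁} with dual ũ and with u(Λ*) < ∞ and u(−Λ*) < ∞, let r > 0, and let Λ̂ minimize Λ ↦ Σ_{i=1}^n ( −yⁱ·⟨Λ, zⁱ⟩ + log(1 + e^{⟨Λ,zⁱ⟩}) ) + r·u(Λ) over ℝ^{b₁}.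 Then, whenever r ≥ ũ( Σ_{i=1}^n (yⁱ − pⁱ)·zⁱ ), it holds that d(Λ̂) ≤ r·u(Λ*) + r·u(−Λ*). -/
open scoped ENNReal RealInnerProductSpace

/-- Hölder's inequality for a regularizer and its dual. -/
theorem IsRegularizer.inner_le {H : Type*} [NormedAddCommGroup H] [InnerProductSpace ℝ H]
    {u : H → ℝ≥0∞} (hu : IsRegularizer u) {G : H} {r : ℝ} (hr : 0 ≤ r)
    (hG : dualReg u G ≤ ENNReal.ofReal r) {Λ : H} (hΛ : u Λ ≠ ⊤) :
    ⟪G, Λ⟫ ≤ r * (u Λ).toReal := by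
  rcases eq_or_ne Λ 0 with rfl | h0
  · simpa using mul_nonneg hr ENNReal.toReal_nonneg
  have hpos : 0 < (u Λ).toReal := ENNReal.toReal_pos (fun h => h0 ((hu.1 Λ).1 h)) hΛ
  have hunit : u ((u Λ).toReal⁻¹ • Λ) ≤ 1 := by
    rw [hu.2 Λ _ h0 (inv_nonneg.2 hpos.le), ← ENNReal.ofReal_toReal hΛ,
      ENNReal.toReal_ofReal hpos.le, ← ENNReal.ofReal_mul (inv_nonneg.2 hpos.le),
      inv_mul_cancel₀ hpos.ne', ENNReal.ofReal_one]
  have hle : ENNReal.ofReal ⟪G, (u Λ).toReal⁻¹ • Λ⟫ ≤ ENNReal.ofReal r :=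
    (le_iSup₂ (f := fun (Λ' : H) (_ : u Λ' ≤ 1) => ENNReal.ofReal ⟪G, Λ'⟫) _ hunit).trans hG
  rwa [ENNReal.ofReal_le_ofReal_iff hr, real_inner_smul_right, inv_mul_le_iff₀ hpos,
    mul_comm] at hle

/-- If a real number plus an extended nonnegative one is bounded by such a sum with finite second
summand, then everything is finite and the inequality holds in `ℝ`. -/
theorem EReal.ne_top_and_add_toReal_le {a b : ℝ} {x y : ℝ≥0∞} (hy : y ≠ ⊤)
    (h : (a : EReal) + (x : EReal) ≤ (b : EReal) + (y : EReal)) :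
    x ≠ ⊤ ∧ a + x.toReal ≤ b + y.toReal := by
  lift y to NNReal using hy
  have hx : x ≠ ⊤ := by
    rintro rfl
    have hlt : (b : EReal) + ((y : ℝ≥0∞) : EReal) < ⊤ := EReal.coe_lt_top (b + (y : ℝ))
    simp at h
    exact hlt.ne h
  lift x to NNReal using hx
  refine ⟨ENNReal.coe_ne_top, ?_⟩
  have h' : ((a + (x : ℝ) : ℝ) : EReal) ≤ ((b + (y : ℝ) : ℝ) : EReal) := h
  exact EReal.coe_le_coe_iff.1 h'

/-- the oracle inequality for regularized logistic regression. -/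
theorem logistic_regression_oracle
    {n b₁ : ℕ}
    (Λstar : EuclideanSpace ℝ (Fin b₁))
    (z : Fin n → EuclideanSpace ℝ (Fin b₁))
    (y : Fin n → ℝ)
    -- the success probabilities `pⁱ = e^{⟨Λ*,zⁱ⟩} / (1 + e^{⟨Λ*,zⁱ⟩})`
    (p : Fin n → ℝ)
    (hp : ∀ i, p i = Real.exp ⟪Λstar, z i⟫ / (1 + Real.exp ⟪Λstar, z i⟫))
    -- the logistic Kullback-Leibler loss
    (d : EuclideanSpace ℝ (Fin b₁) → ℝ)
    (hd : ∀ Λ, d Λ = ∑ i, (p i * ⟪Λstar - Λ, z i⟫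
      - Real.log (1 + Real.exp ⟪Λstar, z i⟫) + Real.log (1 + Real.exp ⟪Λ, z i⟫)))
    (u : EuclideanSpace ℝ (Fin b₁) → ℝ≥0∞)
    (hu : IsRegularizer u) (hufin : u Λstar < ⊤) (hufin' : u (-Λstar) < ⊤)
    (r : ℝ) (hr : 0 < r)
    (Λhat : EuclideanSpace ℝ (Fin b₁))
    (hmin : ∀ Λ : EuclideanSpace ℝ (Fin b₁),
      ((∑ i, (-(y i) * ⟪Λhat, z i⟫ + Real.log (1 + Real.exp ⟪Λhat, z i⟫)) : ℝ) : EReal)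
          + ((ENNReal.ofReal r * u Λhat : ℝ≥0∞) : EReal)
        ≤ ((∑ i, (-(y i) * ⟪Λ, z i⟫ + Real.log (1 + Real.exp ⟪Λ, z i⟫)) : ℝ) : EReal)
          + ((ENNReal.ofReal r * u Λ : ℝ≥0∞) : EReal))
    (hrG : dualReg u (∑ i, (y i - p i) • z i) ≤ ENNReal.ofReal r) :
    d Λhat ≤ r * (u Λstar).toReal + r * (u (-Λstar)).toReal := by
  have hr' : ENNReal.ofReal r ≠ 0 := by simpa using hr
  obtain ⟨htop, hle⟩ := EReal.ne_top_and_add_toReal_le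
    (ENNReal.mul_ne_top ENNReal.ofReal_ne_top hufin.ne) (hmin Λstar)
  have hhat : u Λhat ≠ ⊤ := fun h => htop (by rw [h, ENNReal.mul_top hr'])
  rw [ENNReal.toReal_mul, ENNReal.toReal_mul, ENNReal.toReal_ofReal hr.le] at hle
  have h₁ := hu.inner_le hr.le hrG hhat
  have h₂ := hu.inner_le hr.le hrG hufin'.ne
  have hdecomp : d Λhat
      = ∑ i, (-(y i) * ⟪Λhat, z i⟫ + Real.log (1 + Real.exp ⟪Λhat, z i⟫))
        - ∑ i, (-(y i) * ⟪Λstar, z i⟫ + Real.log (1 + Real.exp ⟪Λstar, z i⟫))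
        + ⟪∑ i, (y i - p i) • z i, Λhat⟫ + ⟪∑ i, (y i - p i) • z i, -Λstar⟫ := by
    rw [hd, sum_inner, sum_inner, ← Finset.sum_sub_distrib, ← Finset.sum_add_distrib,
      ← Finset.sum_add_distrib]
    refine Finset.sum_congr rfl fun i _ => ?_
    rw [real_inner_smul_left, real_inner_smul_left, inner_neg_right, inner_sub_left,
      real_inner_comm Λhat (z i), real_inner_comm Λstar (z i)]
    ring
  linarith
end

section
/- Let H be a real Hilbert space, L ⊆ H a nonempty convex subset, a : L → ℝ a function, and Λ* ∈ L. Let T¹,…,Tⁿ ∈ H (the observed sufficient statistics) and M¹,…,Mⁿ ∈ H (their means under the true parameter Λ*). Define the Kullback–Leibler loss d(Λ) := ⟨Σ_{i=1}^n Mⁱ, Λ − Λ*⟩ − n·a(Λ*) + n·a(Λ). Let u be a regularizer on H with dual ũ and with u(Λ*) < ∞ and u(−Λ*) < ∞, let r > 0, and let Λ̂ ∈ L minimize Λ ↦ Σ_{i=1}^n ⟨Λ, Tⁱ⟩ + n·a(Λ) + r·u(Λ) over L. Then, whenever r ≥ ũ( Σ_{i=1}^n (Mⁱ − Tⁱ)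 ), it holds that d(Λ̂) ≤ r·u(Λ*) + r·u(−Λ*). -/
open scoped ENNReal RealInnerProductSpace

/-- The generalized Hölder inequality for a regularizer and its dual. -/
theorem inner_le_mul_toReal_of_dualReg_le {H : Type*} [NormedAddCommGroup H]
    [InnerProductSpace ℝ H] {u : H → ℝ≥0∞} (hu : IsRegularizer u) {r : ℝ} (hr : 0 ≤ r) {G : H}
    (hG : dualReg u G ≤ ENNReal.ofReal r) {x : H} (hx : u x < ⊤) :
    ⟪G, x⟫ ≤ r * (u x).toReal := by
  by_cases h0 : x = 0
  · subst h0
    simpa using mul_nonneg hr ENNReal.toReal_nonneg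
  have hpos : 0 < (u x).toReal :=
    ENNReal.toReal_pos (fun h => h0 ((hu.1 x).1 h)) hx.ne
  have hle : u ((u x).toReal⁻¹ • x) ≤ 1 := by
    rw [hu.2 x _ h0 (inv_nonneg.2 hpos.le)]
    nth_rewrite 2 [← ENNReal.ofReal_toReal hx.ne]
    rw [← ENNReal.ofReal_mul (inv_nonneg.2 hpos.le), inv_mul_cancel₀ hpos.ne',
      ENNReal.ofReal_one]
  have hdual : ENNReal.ofReal ⟪G, (u x).toReal⁻¹ • x⟫ ≤ ENNReal.ofReal r :=
    (le_iSup₂ (f := fun (y : H) (_ : u y ≤ 1) => ENNReal.ofReal ⟪G, y⟫) _ hle).trans hG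
  rw [ENNReal.ofReal_le_ofReal_iff hr, real_inner_smul_right, inv_mul_le_iff₀ hpos] at hdual
  linarith

/-- the oracle inequality for exponential trace graphical models. -/
theorem exponential_trace_oracle
    {H : Type*} [NormedAddCommGroup H] [InnerProductSpace ℝ H] [CompleteSpace H]
    (L : Set H) (hLne : L.Nonempty) (hLconv : Convex ℝ L)
    (a : H → ℝ)
    (Λstar : H) (hΛstar : Λstar ∈ L)
    {n : ℕ}
    -- the observed sufficient statistics and their means under `Λ*`
    (T M : Fin n → H)
    -- the Kullback-Leibler loss
    (d : H → ℝ)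
    (hd : ∀ Λ, d Λ = ⟪∑ i, M i, Λ - Λstar⟫ - n * a Λstar + n * a Λ)
    (u : H → ℝ≥0∞) (hu : IsRegularizer u)
    (hufin : u Λstar < ⊤) (hufin' : u (-Λstar) < ⊤)
    (r : ℝ) (hr : 0 < r)
    (Λhat : H) (hΛhat : Λhat ∈ L)
    (hmin : ∀ Λ ∈ L,
      ((∑ i, ⟪Λhat, T i⟫ + n * a Λhat : ℝ) : EReal)
          + ((ENNReal.ofReal r * u Λhat : ℝ≥0∞) : EReal)
        ≤ ((∑ i, ⟪Λ, T i⟫ + n * a Λ : ℝ) : EReal)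
          + ((ENNReal.ofReal r * u Λ : ℝ≥0∞) : EReal))
    (hrG : dualReg u (∑ i, (M i - T i)) ≤ ENNReal.ofReal r) :
    d Λhat ≤ r * (u Λstar).toReal + r * (u (-Λstar)).toReal := by
  have hm := hmin Λstar hΛstar
  have hstar : ENNReal.ofReal r * u Λstar ≠ ⊤ := ENNReal.mul_ne_top ENNReal.ofReal_ne_top hufin.ne
  have hhat : u Λhat ≠ ⊤ := by
    intro h
    rw [h, ENNReal.mul_top (by simpa using hr), ← ENNReal.ofReal_toReal hstar,
      EReal.coe_ennreal_top, EReal.coe_add_top, EReal.coe_ennreal_ofReal, ← EReal.coe_add] at hm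
    exact EReal.coe_ne_top _ (top_le_iff.1 hm)
  have hhat' : ENNReal.ofReal r * u Λhat ≠ ⊤ := ENNReal.mul_ne_top ENNReal.ofReal_ne_top hhat
  rw [← EReal.coe_ennreal_toReal hstar, ← EReal.coe_ennreal_toReal hhat', ← EReal.coe_add,
    ← EReal.coe_add, EReal.coe_le_coe_iff, ENNReal.toReal_mul, ENNReal.toReal_mul,
    ENNReal.toReal_ofReal hr.le, ← inner_sum, ← inner_sum] at hm
  have hG₁ := inner_le_mul_toReal_of_dualReg_le hu hr.le hrG hhat.lt_top
  have hG₂ := inner_le_mul_toReal_of_dualReg_le hu hr.le hrG hufin'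
  rw [Finset.sum_sub_distrib, inner_sub_left] at hG₁ hG₂
  rw [inner_neg_right, inner_neg_right] at hG₂
  rw [real_inner_comm, real_inner_comm (∑ i, T i) Λstar] at hm
  rw [hd, inner_sub_right]
  linarith
end

section
/- Let Λ* be a positive definite real p×p matrix and X¹,…,Xⁿ ∈ ℝ^p arbitrary vectors. Let r' > 0 and let Λ̂ minimize Λ ↦ (1/n)·Σ_{i=1}^n tr(Xⁱ(Xⁱ)ᵀΛ) − log det Λ + r'·Σ_{i₁,i₂}|Λ_{i₁i₂}| over the set of positive definite p×p matrices. Then, whenever r' ≥ max_{i₁,i₂} |( (Λ*)^{-1} − (1/n)·Σ_{i=1}^n Xⁱ(Xⁱ)ᵀ )_{i₁i₂}|, it holds that tr(Λ̂·(Λ*)^{-1}) − log det Λ̂ + log det Λ* − p ≤ 2·r'·Σ_{i₁,i₂}|Λ*_{i₁i₂}|. -/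
open Matrix

theorem abs_trace_mul_le_of_abs_entry_le {m n : Type*} [Fintype m] [Fintype n]
    {A : Matrix m n ℝ} {r : ℝ} (hA : ∀ i j, |A i j| ≤ r) (B : Matrix n m ℝ) :
    |(A * B).trace| ≤ r * ∑ j, ∑ i, |B j i| := by
  rw [trace_mul_comm]
  simp only [trace, diag_apply, mul_apply, Finset.mul_sum]
  refine (Finset.abs_sum_le_sum_abs _ _).trans (Finset.sum_le_sum fun j _ => ?_)
  refine (Finset.abs_sum_le_sum_abs _ _).trans (Finset.sum_le_sum fun i _ => ?_)
  rw [abs_mul, mul_comm]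
  exact mul_le_mul_of_nonneg_right (hA i j) (abs_nonneg _)

/-- the deterministic oracle inequality for the graphical lasso in
Stein's loss. -/
theorem graphical_lasso_oracle
    {p n : ℕ} (hn : 0 < n)
    (Λstar : Matrix (Fin p) (Fin p) ℝ) (hΛstar : Λstar.PosDef)
    (X : Fin n → Fin p → ℝ)
    (r' : ℝ) (hr' : 0 < r')
    (Λhat : Matrix (Fin p) (Fin p) ℝ) (hΛhat : Λhat.PosDef)
    (hmin : ∀ Λ : Matrix (Fin p) (Fin p) ℝ, Λ.PosDef →
      (1 / n * ∑ i, (vecMulVec (X i) (X i) * Λhat).trace) - Real.log Λhat.det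
          + r' * ∑ i₁, ∑ i₂, |Λhat i₁ i₂|
        ≤ (1 / n * ∑ i, (vecMulVec (X i) (X i) * Λ).trace) - Real.log Λ.det
          + r' * ∑ i₁, ∑ i₂, |Λ i₁ i₂|)
    (hrcond : ∀ i₁ i₂,
      |(Λstar⁻¹ - (1 / n : ℝ) • ∑ i, vecMulVec (X i) (X i)) i₁ i₂| ≤ r') :
    (Λhat * Λstar⁻¹).trace - Real.log Λhat.det + Real.log Λstar.det - p
      ≤ 2 * r' * ∑ i₁, ∑ i₂, |Λstar i₁ i₂| := by
  have hsample : ∀ Λ : Matrix (Fin p) (Fin p) ℝ,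
      1 / n * ∑ i, (vecMulVec (X i) (X i) * Λ).trace
        = (((1 / n : ℝ) • ∑ i, vecMulVec (X i) (X i)) * Λ).trace := fun Λ => by
    rw [Matrix.smul_mul, trace_smul, Finset.sum_mul, trace_sum, smul_eq_mul]
  have hopt := hmin Λstar hΛstar
  rw [hsample, hsample] at hopt
  have hhat := (abs_le.mp (abs_trace_mul_le_of_abs_entry_le hrcond Λhat)).2
  have hstar := (abs_le.mp (abs_trace_mul_le_of_abs_entry_le hrcond Λstar)).1
  have hinv : (Λstar⁻¹ * Λstar).trace = p := by
    rw [nonsing_inv_mul _ hΛstar.det_pos.ne'.isUnit, trace_one, Fintype.card_fin]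
  rw [Matrix.sub_mul, trace_sub] at hhat hstar
  rw [trace_mul_comm]
  linarith
end

section
/- Let β* ∈ ℝ^{b₁}, let z¹,…,zⁿ ∈ ℝ^{b₁} be covariate row-vectors and y¹,…,yⁿ ∈ ℝ responses, and set εⁱ := yⁱ − ⟨zⁱ, β*⟩. Let r' > 0 and let β̂ minimize β ↦ Σ_{i=1}^n (yⁱ − ⟨zⁱ, β⟩)² + r'·‖β‖₁ over ℝ^{b₁}, where ‖β‖₁ = Σ_j |β_j|. Then, whenever r' ≥ 2·max_j |Σ_{i=1}^n z_jⁱ·εⁱ|, it holds that Σ_{i=1}^n (⟨zⁱ, β*⟩ − ⟨zⁱ, β̂⟩)² ≤ 2·r'·‖β*‖₁. -/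
open scoped RealInnerProductSpace

/-- the assumptionless prediction bound for the lasso in linear
regression. -/
theorem lasso_prediction_bound
    {n b₁ : ℕ}
    (βstar : EuclideanSpace ℝ (Fin b₁))
    (z : Fin n → EuclideanSpace ℝ (Fin b₁))
    (y : Fin n → ℝ)
    (ε : Fin n → ℝ) (hε : ∀ i, ε i = y i - ⟪z i, βstar⟫)
    (r' : ℝ) (hr' : 0 < r')
    (βhat : EuclideanSpace ℝ (Fin b₁))
    (hmin : ∀ β : EuclideanSpace ℝ (Fin b₁),
      ∑ i, (y i - ⟪z i, βhat⟫) ^ 2 + r' * ∑ j, |βhat j|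
        ≤ ∑ i, (y i - ⟪z i, β⟫) ^ 2 + r' * ∑ j, |β j|)
    (hrcond : ∀ j, 2 * |∑ i, z i j * ε i| ≤ r') :
    ∑ i, (⟪z i, βstar⟫ - ⟪z i, βhat⟫) ^ 2 ≤ 2 * r' * ∑ j, |βstar j| := by
  have hcross : 2 * ∑ i, ε i * (⟪z i, βhat⟫ - ⟪z i, βstar⟫)
      ≤ r' * ∑ j, |βhat j| + r' * ∑ j, |βstar j| := by
    have hswap : ∑ i, ε i * (⟪z i, βhat⟫ - ⟪z i, βstar⟫)
        = ∑ j, (βhat j - βstar j) * ∑ i, z i j * ε i := by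
      simp only [← inner_sub_right]
      simp only [PiLp.inner_apply, Finset.mul_sum]
      rw [Finset.sum_comm]
      refine Finset.sum_congr rfl fun j _ => Finset.sum_congr rfl fun i _ => ?_
      simp only [RCLike.inner_apply, conj_trivial, PiLp.sub_apply]
      ring
    rw [hswap, Finset.mul_sum, Finset.mul_sum, Finset.mul_sum, ← Finset.sum_add_distrib]
    refine Finset.sum_le_sum fun j _ => ?_
    calc 2 * ((βhat j - βstar j) * ∑ i, z i j * ε i)
        ≤ 2 * (|βhat j - βstar j| * |∑ i, z i j * ε i|) := by
          rw [← abs_mul]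
          gcongr
          exact le_abs_self _
      _ = (2 * |∑ i, z i j * ε i|) * |βhat j - βstar j| := by ring
      _ ≤ r' * (|βhat j| + |βstar j|) := by
          gcongr
          · exact hrcond j
          · exact abs_sub _ _
      _ = r' * |βhat j| + r' * |βstar j| := by ring
  have hexpand : ∑ i, (y i - ⟪z i, βhat⟫) ^ 2
      = ∑ i, (y i - ⟪z i, βstar⟫) ^ 2 - 2 * ∑ i, ε i * (⟪z i, βhat⟫ - ⟪z i, βstar⟫)
        + ∑ i, (⟪z i, βstar⟫ - ⟪z i, βhat⟫) ^ 2 := by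
    rw [Finset.mul_sum, ← Finset.sum_sub_distrib, ← Finset.sum_add_distrib]
    refine Finset.sum_congr rfl fun i _ => ?_
    rw [hε i]
    ring
  linarith [hmin βstar]
end
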